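/- arXiv:2208.11917 — 4 statements merged into one kernel-verified Lean document; each statement's English description precedes it below -/
import Mathlib

section
/- For every context C, the set of expected states of C equals the set of expected states of its core: e(C) = e(C^τ). -/
open Classical in
/-- Greedy intersection: keep intersecting with successive defaults as long as nonempty. -/
noncomputable def eAux {W : Type*} : Set W → List (Set W) → Set W
  | A, [] => A
  | A, E :: rest => if (A ∩ E).Nonempty then eAux (A ∩ E) rest else A

/-- Expected states of a context (list of defaults). -/
noncomputable def expect {W : Type*} : List (Set W) → Set W
  | [] => Set.univ
  | D :: rest => eAux D rest

open Classical in
/-- Core of a context: keep only the leftmost occurrence of each default. -/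
noncomputable def core {W : Type*} : List (Set W) → List (Set W)
  | [] => []
  | D :: rest => D :: (core rest).filter (fun E => decide (E ≠ D))

theorem eAux_empty {W : Type*} (l : List (Set W)) : eAux ∅ l = ∅ := by
  cases l <;> simp [eAux]

theorem eAux_filter_ne {W : Type*} {D : Set W} (p : Set W → Bool)
    (hp : ∀ E, p E = false → E = D) (l : List (Set W)) {A : Set W} (hA : A ⊆ D) :
    eAux A (l.filter p) = eAux A l := by
  induction l generalizing A with
  | nil => rfl
  | cons E l ih =>
    rcases A.eq_empty_or_nonempty with rfl | hne
    · rw [eAux_empty, eAux_empty]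
    cases hE : p E with
    | true =>
      rw [List.filter_cons_of_pos hE, eAux, eAux, ih (Set.inter_subset_left.trans hA)]
    | false =>
      obtain rfl := hp E hE
      rw [List.filter_cons_of_neg (by simp [hE]), ih hA, eAux,
        Set.inter_eq_left.2 hA, if_pos hne]

theorem eAux_core {W : Type*} (A : Set W) (l : List (Set W)) :
    eAux A (core l) = eAux A l := by
  induction l generalizing A with
  | nil => rfl
  | cons E l ih =>
    rw [core, eAux, eAux, eAux_filter_ne (D := E) _ (by simp) _ Set.inter_subset_right, ih]

/-- For every context C (a nonempty finite sequence of defaults), the set of expected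
states of C equals the set of expected states of its core: e(C) = e(C^τ). -/
theorem expect_core (W : Type*) [Nonempty W] (C : List (Set W)) (hC : C ≠ []) :
    expect C = expect (core C) := by
  cases C with
  | nil => rfl
  | cons D l =>
    rw [core, expect, expect, eAux_filter_ne (D := D) _ (by simp) _ subset_rfl, eAux_core]
end

section
/- Let χ be a closed formula of ConWON, M a model, C a context for M, and α a propositional formula such that e(⟦α⟧;C) ≠ ∅. Then for all states w and u of M: M, C, w ⊨ [α]χ if and only if M, ⟦α⟧;C, u ⊨ χ. -/
/-- Propositional formulas over a countable set of atoms (identified with ℕ). -/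
inductive PForm : Type
  | atom : ℕ → PForm
  | fls : PForm
  | neg : PForm → PForm
  | conj : PForm → PForm → PForm

/-- The language ConWON: propositional connectives plus the conditional [α]φ
with propositional antecedent. -/
inductive Form : Type
  | atom : ℕ → Form
  | fls : Form
  | neg : Form → Form
  | conj : Form → Form → Form
  | cond : PForm → Form → Form

/-- Extension ⟦α⟧ of a propositional formula in a model (W, V). -/
def pval {W : Type*} (V : ℕ → Set W) : PForm → Set W
  | .atom n => V n
  | .fls => ∅
  | .neg a => (pval V a)ᶜ
  | .conj a b => pval V a ∩ pval V b

/-- Truth at a contextualized pointed model: M,C,w ⊨ φ. -/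
def sat {W : Type*} (V : ℕ → Set W) : List (Set W) → W → Form → Prop
  | _, w, .atom n => w ∈ V n
  | _, _, .fls => False
  | C, w, .neg φ => ¬ sat V C w φ
  | C, w, .conj φ ψ => sat V C w φ ∧ sat V C w ψ
  | C, _, .cond α φ => ∀ u ∈ expect (pval V α :: C), sat V (pval V α :: C) u φ

universe u

/-- Validity in ConWON: truth at every contextualized pointed model. -/
def valid (φ : Form) : Prop :=
  ∀ (W : Type u) (_ : Nonempty W) (V : ℕ → Set W) (C : List (Set W)),
    C ≠ [] → ∀ w : W, sat V C w φ

def Form.top : Form := .neg .fls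
def Form.or (φ ψ : Form) : Form := .neg (.conj (.neg φ) (.neg ψ))
def Form.imp (φ ψ : Form) : Form := .neg (.conj φ (.neg ψ))
def Form.iff (φ ψ : Form) : Form := .conj (.imp φ ψ) (.imp ψ φ)
/-- ⟨α⟩φ := ¬[α]¬φ. -/
def Form.dia (α : PForm) (φ : Form) : Form := .neg (.cond α (.neg φ))
/-- Eα := ⟨α⟩⊤. -/
def Form.E (α : PForm) : Form := Form.dia α Form.top
/-- Aα := ¬E¬α. -/
def Form.A (α : PForm) : Form := .neg (Form.E (.neg α))
def PForm.imp (a b : PForm) : PForm := .neg (.conj a (.neg b))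

/-- Embedding of propositional formulas into ConWON. -/
def pToForm : PForm → Form
  | .atom n => .atom n
  | .fls => .fls
  | .neg a => .neg (pToForm a)
  | .conj a b => .conj (pToForm a) (pToForm b)

/-- Closed formulas: χ ::= [α]φ | ¬χ | (χ∧χ). -/
inductive Closed : Form → Prop
  | cond (α : PForm) (φ : Form) : Closed (.cond α φ)
  | neg {χ : Form} : Closed χ → Closed (.neg χ)
  | conj {χ₁ χ₂ : Form} : Closed χ₁ → Closed χ₂ → Closed (.conj χ₁ χ₂)

/-- Conditional-free formulas of ConWON. -/
def CondFree : Form → Prop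
  | .atom _ => True
  | .fls => True
  | .neg φ => CondFree φ
  | .conj φ ψ => CondFree φ ∧ CondFree ψ
  | .cond _ _ => False

/-- The flat fragment ConWON-1: no conditional occurs inside another conditional. -/
def Flat : Form → Prop
  | .atom _ => True
  | .fls => True
  | .neg φ => Flat φ
  | .conj φ ψ => Flat φ ∧ Flat ψ
  | .cond _ φ => CondFree φ

theorem Closed.sat_iff_sat {χ : Form} (hχ : Closed χ) {W : Type*} (V : ℕ → Set W)
    (C : List (Set W)) (v w : W) : sat V C v χ ↔ sat V C w χ := by
  induction hχ with
  | cond α φ => simp only [sat]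
  | neg _ ih => simp only [sat, ih]
  | conj _ _ ih₁ ih₂ => simp only [sat, ih₁, ih₂]

/-- For closed χ, if e(⟦α⟧;C) ≠ ∅, then M,C,w ⊨ [α]χ iff M,⟦α⟧;C,u ⊨ χ,
for all states w and u. -/
theorem cond_closed_iff (χ : Form) (hχ : Closed χ) (W : Type*) [Nonempty W]
    (V : ℕ → Set W) (C : List (Set W)) (hC : C ≠ []) (α : PForm)
    (hne : expect (pval V α :: C) ≠ ∅) (w u : W) :
    sat V C w (.cond α χ) ↔ sat V (pval V α :: C) u χ := by
  obtain ⟨v, hv⟩ := Set.nonempty_iff_ne_empty.mpr hne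
  simp only [sat]
  exact ⟨fun h => (hχ.sat_iff_sat V _ v u).mp (h v hv),
    fun h x _ => (hχ.sat_iff_sat V _ u x).mp h⟩
end

section
/- For every propositional formula α, every formula φ of ConWON, and every closed formula χ of ConWON, the formula [α](φ∨χ) ↔ ([α]φ ∨ [α]χ) is valid in ConWON. -/
universe u

/-- The truth value of a closed formula does not depend on the current state. -/
theorem Closed.sat_iff {W : Type*} {V : ℕ → Set W} {C : List (Set W)} {χ : Form}
    (hχ : Closed χ) (w v : W) : sat V C w χ ↔ sat V C v χ := by
  induction hχ with
  | cond α φ => simp only [sat]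
  | neg _ ih => simp only [sat, ih]
  | conj _ _ ih₁ ih₂ => simp only [sat, ih₁, ih₂]

theorem sat_or {W : Type*} {V : ℕ → Set W} {C : List (Set W)} {w : W} {φ ψ : Form} :
    sat V C w (Form.or φ ψ) ↔ sat V C w φ ∨ sat V C w ψ := by
  simp only [Form.or, sat]
  tauto

theorem sat_iff {W : Type*} {V : ℕ → Set W} {C : List (Set W)} {w : W} {φ ψ : Form} :
    sat V C w (Form.iff φ ψ) ↔ (sat V C w φ ↔ sat V C w ψ) := by
  simp only [Form.iff, Form.imp, sat]
  tauto

/-- For closed χ, [α](φ∨χ) ↔ ([α]φ ∨ [α]χ) is valid in ConWON. -/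
theorem valid_cond_or_closed (α : PForm) (φ χ : Form) (hχ : Closed χ) :
    valid (Form.iff (.cond α (Form.or φ χ)) (Form.or (.cond α φ) (.cond α χ))) := by
  intro W _ V C _ w
  simp only [sat_iff, sat_or, sat]
  constructor
  · intro h
    by_cases hc : ∀ u ∈ expect (pval V α :: C), sat V (pval V α :: C) u χ
    · exact Or.inr hc
    · push Not at hc
      obtain ⟨v, -, hv⟩ := hc
      exact Or.inl fun u hu => (h u hu).resolve_right fun hu' => hv ((hχ.sat_iff u v).mp hu')
  · rintro (h | h) u hu
    · exact Or.inl (h u hu)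
    · exact Or.inr (h u hu)
end

section
/- Let W be a nonempty set and X₀, …, X_k subsets of W with X₀ = W. Define Y_i = (X₀ ∩ … ∩ X_i) \ X_{i+1} for 0 ≤ i < k, and Y_k = X₀ ∩ … ∩ X_k. Then for every Z ⊆ W: (1) if l is the greatest index with l ≤ k and Z ∩ X₀ ∩ … ∩ X_l ≠ ∅, then Z ∩ X₀ ∩ … ∩ X_l = Z ∩ Y_l and l is the greatest index with Z ∩ Y_l ≠ ∅; (2) if l is the greatest index with l ≤ k and Z ∩ Y_l ≠ ∅, then Z ∩ X₀ ∩ … ∩ X_l = Z ∩ Y_l and l is the greatest index with Z ∩ X₀ ∩ … ∩ X_l ≠ ∅. -/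
theorem inter_eq_inter_of_forall_gt_inter_eq_empty {W : Type*} {k : ℕ} {C Y : ℕ → Set W}
    (hY : ∀ i, i < k → Y i = C i \ C (i + 1)) (hYk : Y k = C k) {Z : Set W} {l : ℕ}
    (hl : l ≤ k) (h : ∀ m, l < m → m ≤ k → Z ∩ C m = ∅) : Z ∩ C l = Z ∩ Y l := by
  rcases hl.eq_or_lt with rfl | hlt
  · rw [hYk]
  · rw [hY l hlt, ← Set.inter_sdiff_assoc, Set.inter_sdiff_right_comm,
      (Set.disjoint_iff_inter_eq_empty.2 (h (l + 1) l.lt_succ_self hlt)).sdiff_eq_left]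

theorem inter_eq_empty_of_forall_gt_inter_eq_empty {W : Type*} {k : ℕ} {C Y : ℕ → Set W}
    (hY : ∀ i, i < k → Y i = C i \ C (i + 1)) (hYk : Y k = C k) {Z : Set W} {l : ℕ}
    (h : ∀ m, l < m → m ≤ k → Z ∩ Y m = ∅) (m : ℕ) (hlm : l < m) (hmk : m ≤ k) :
    Z ∩ C m = ∅ := by
  induction hn : k - m using Nat.strong_induction_on generalizing m with
  | _ n ih =>
    rw [inter_eq_inter_of_forall_gt_inter_eq_empty hY hYk hmk
      fun m' hm' hm'k => ih (k - m') (by omega) m' (hlm.trans hm') hm'k rfl]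
    exact h m hlm hmk

/-- Let X₀, …, X_k be subsets of W with X₀ = W, and define
Y_i = (X₀ ∩ … ∩ X_i) \ X_{i+1} for i < k and Y_k = X₀ ∩ … ∩ X_k.
Then for every Z ⊆ W:
(1) if l is the greatest index ≤ k with Z ∩ X₀ ∩ … ∩ X_l ≠ ∅, then
    Z ∩ X₀ ∩ … ∩ X_l = Z ∩ Y_l and l is the greatest index with Z ∩ Y_l ≠ ∅;
(2) if l is the greatest index ≤ k with Z ∩ Y_l ≠ ∅, then
    Z ∩ X₀ ∩ … ∩ X_l = Z ∩ Y_l and l is the greatest index with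
    Z ∩ X₀ ∩ … ∩ X_l ≠ ∅. -/
theorem from_contexts_to_spheres (W : Type*) [Nonempty W] (k : ℕ) (X Y : ℕ → Set W)
    (hX0 : X 0 = Set.univ)
    (hY : ∀ i, i < k → Y i = (⋂ j ∈ Set.Iic i, X j) \ X (i + 1))
    (hYk : Y k = ⋂ j ∈ Set.Iic k, X j)
    (Z : Set W) :
    (∀ l, l ≤ k → Z ∩ (⋂ i ∈ Set.Iic l, X i) ≠ ∅ →
      (∀ m, l < m → m ≤ k → Z ∩ (⋂ i ∈ Set.Iic m, X i) = ∅) →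
      Z ∩ (⋂ i ∈ Set.Iic l, X i) = Z ∩ Y l ∧
      Z ∩ Y l ≠ ∅ ∧ (∀ m, l < m → m ≤ k → Z ∩ Y m = ∅)) ∧
    (∀ l, l ≤ k → Z ∩ Y l ≠ ∅ →
      (∀ m, l < m → m ≤ k → Z ∩ Y m = ∅) →
      Z ∩ (⋂ i ∈ Set.Iic l, X i) = Z ∩ Y l ∧
      Z ∩ (⋂ i ∈ Set.Iic l, X i) ≠ ∅ ∧
      (∀ m, l < m → m ≤ k → Z ∩ (⋂ i ∈ Set.Iic m, X i) = ∅)) := by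
  set C : ℕ → Set W := fun i => ⋂ j ∈ Set.Iic i, X j with hC
  have hYC : ∀ i, i < k → Y i = C i \ C (i + 1) := fun i hi => by
    have hsucc : C (i + 1) = C i ∩ X (i + 1) := by
      simp only [hC, Set.mem_Iic]
      exact Set.biInter_le_succ X i
    rw [hY i hi, hsucc, Set.sdiff_self_inter]
  have hsub : ∀ m, m ≤ k → Y m ⊆ C m := fun m hm => by
    rcases hm.eq_or_lt with rfl | hlt
    · exact hYk.subset
    · exact (hYC m hlt).trans_subset Set.sdiff_subset
  refine ⟨fun l hl hne hgt => ?_, fun l hl hne hgt => ?_⟩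
  · have heq := inter_eq_inter_of_forall_gt_inter_eq_empty hYC hYk hl hgt
    exact ⟨heq, heq ▸ hne, fun m hlm hmk => Set.subset_eq_empty
      (Set.inter_subset_inter_right Z (hsub m hmk)) (hgt m hlm hmk)⟩
  · have hgtC := inter_eq_empty_of_forall_gt_inter_eq_empty hYC hYk hgt
    have heq := inter_eq_inter_of_forall_gt_inter_eq_empty hYC hYk hl hgtC
    exact ⟨heq, heq.trans_ne hne, hgtC⟩
end
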